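/- Suppose S and T are inverse semigroups with zero elements, both satisfying (P3) and (P4). Then S is Morita equivalent to T (i.e., the categories L(S) and L(T) are equivalent) if and only if the path categories P(S) and P(T) are equivalent. -/

import Mathlib

universe u v

/-- An inverse semigroup. -/
class InverseSemigroup (S : Type*) extends Semigroup S, Star S where
  mul_star_mul_self : ∀ s : S, s * star s * s = s
  star_mul_self_mul_star : ∀ s : S, star s * s * star s = star s
  star_unique : ∀ s a : S, s * a * s = s → a * s * a = a → a = star s

/-- Idempotent element. -/
def IsIdem {S : Type*} [Mul S] (e : S) : Prop := e * e = e

/-- The natural partial order: `s ≤ t` iff `s = t * e` for some idempotent `e`. -/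
def NLe {S : Type*} [InverseSemigroup S] (s t : S) : Prop :=
  ∃ e : S, IsIdem e ∧ s = t * e

/-- `e` is a maximal idempotent (with zero `z`): `e` is a nonzero idempotent
maximal among the nonzero idempotents in the natural partial order. -/
def IsMaxIdem {S : Type*} [InverseSemigroup S] (z e : S) : Prop :=
  IsIdem e ∧ e ≠ z ∧ ∀ f : S, IsIdem f → f ≠ z → NLe e f → f = e

/-- `(e, s)` is a morphism of the path category `P(S)` (with zero `z`), from the
maximal idempotent `e` to the maximal idempotent `star s * s`: `star s * s` is
maximal and `(s * star s)° = e`, i.e. (assuming (P3)) `e` is maximal,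
`s * star s ≠ z` and `s * star s ≤ e`. -/
def PMor {S : Type*} [InverseSemigroup S] (z e s : S) : Prop :=
  IsMaxIdem z e ∧ IsMaxIdem z (star s * s) ∧ s * star s ≠ z ∧ NLe (s * star s) e

/-- An equivalence of categories `L(S) ≃ L(T)`, expressed elementarily as a
functor that is full, faithful and essentially surjective.  Objects of `L(S)`
are the idempotents of `S`; a morphism `e → star s * s` is a triple
`(e, s, star s * s)` with `s * star s ≤ e`, determined by the pair `(e, s)`. -/
def IsLEquiv {S : Type u} {T : Type v} [InverseSemigroup S] [InverseSemigroup T]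
    (F0 : S → T) (F1 : S → S → T) : Prop :=
  (∀ e : S, IsIdem e → IsIdem (F0 e)) ∧
  (∀ e s : S, IsIdem e → NLe (s * star s) e →
    NLe (F1 e s * star (F1 e s)) (F0 e) ∧ star (F1 e s) * F1 e s = F0 (star s * s)) ∧
  (∀ e : S, IsIdem e → F1 e e = F0 e) ∧
  (∀ e s t : S, IsIdem e → NLe (s * star s) e → NLe (t * star t) (star s * s) →
    F1 e (s * t) = F1 e s * F1 (star s * s) t) ∧
  (∀ e s s' : S, IsIdem e → NLe (s * star s) e → NLe (s' * star s') e →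
    star s * s = star s' * s' → F1 e s = F1 e s' → s = s') ∧
  (∀ e f : S, ∀ u : T, IsIdem e → IsIdem f → NLe (u * star u) (F0 e) →
    star u * u = F0 f → ∃ s : S, NLe (s * star s) e ∧ star s * s = f ∧ F1 e s = u) ∧
  (∀ g : T, IsIdem g → ∃ e : S, IsIdem e ∧
    ∃ x y : T, NLe (x * star x) (F0 e) ∧ star x * x = g ∧ NLe (y * star y) g ∧
      star y * y = F0 e ∧ x * y = F0 e ∧ y * x = g)

/-- `S` and `T` are Morita equivalent: the categories `L(S)` and `L(T)` are
equivalent. -/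
def MoritaEquiv (S : Type u) (T : Type v) [InverseSemigroup S]
    [InverseSemigroup T] : Prop :=
  ∃ (F0 : S → T) (F1 : S → S → T), IsLEquiv F0 F1

/-- An equivalence of the path categories `P(S) ≃ P(T)` (with zeros `zS`, `zT`),
expressed elementarily as a functor that is full, faithful and essentially
surjective.  Objects of `P(S)` are the maximal idempotents; a morphism
`e → star s * s` is a pair `(e, s)` satisfying `PMor zS e s`. -/
def IsPEquiv {S : Type u} {T : Type v} [InverseSemigroup S] [InverseSemigroup T]
    (zS : S) (zT : T) (F0 : S → T) (F1 : S → S → T) : Prop :=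
  -- sends objects to objects
  (∀ e : S, IsMaxIdem zS e → IsMaxIdem zT (F0 e)) ∧
  -- sends the morphism `(e, s) : e → star s * s` to a morphism `F0 e → F0 (star s * s)`
  (∀ e s : S, PMor zS e s →
    PMor zT (F0 e) (F1 e s) ∧ star (F1 e s) * F1 e s = F0 (star s * s)) ∧
  -- preserves identities
  (∀ e : S, IsMaxIdem zS e → F1 e e = F0 e) ∧
  -- preserves composition
  (∀ e s t : S, PMor zS e s → PMor zS (star s * s) t →
    F1 e (s * t) = F1 e s * F1 (star s * s) t) ∧
  -- faithful
  (∀ e s s' : S, PMor zS e s → PMor zS e s' →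
    star s * s = star s' * s' → F1 e s = F1 e s' → s = s') ∧
  -- full
  (∀ e f : S, ∀ u : T, IsMaxIdem zS e → IsMaxIdem zS f →
    PMor zT (F0 e) u → star u * u = F0 f →
    ∃ s : S, PMor zS e s ∧ star s * s = f ∧ F1 e s = u) ∧
  -- essentially surjective: every object of `P(T)` is isomorphic in `P(T)` to some `F0 e`
  (∀ g : T, IsMaxIdem zT g → ∃ e : S, IsMaxIdem zS e ∧
    ∃ x y : T, PMor zT (F0 e) x ∧ star x * x = g ∧ PMor zT g y ∧
      star y * y = F0 e ∧ x * y = F0 e ∧ y * x = g)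

namespace InverseSemigroup

variable {S : Type*} [InverseSemigroup S]

theorem star_star' (s : S) : star (star s) = s :=
  (star_unique (star s) s (star_mul_self_mul_star s) (mul_star_mul_self s)).symm

theorem star_eq_self {e : S} (he : IsIdem e) : star e = e := by
  have h : e * e = e := he
  exact (star_unique e e (by rw [h, h]) (by rw [h, h])).symm

theorem isIdem_star_mul_self (s : S) : IsIdem (star s * s) := by
  rw [IsIdem, ← mul_assoc, star_mul_self_mul_star]

theorem isIdem_mul_star_self (s : S) : IsIdem (s * star s) := by
  rw [IsIdem, ← mul_assoc, mul_star_mul_self]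

theorem isIdem_mul {e f : S} (he : IsIdem e) (hf : IsIdem f) : IsIdem (e * f) := by
  have he' : e * e = e := he
  have hf' : f * f = f := hf
  have he2 (a : S) : e * (e * a) = e * a := by rw [← mul_assoc, he']
  have hf2 (a : S) : f * (f * a) = f * a := by rw [← mul_assoc, hf']
  set x := star (e * f) with hx
  have h1 : e * f * x * (e * f) = e * f := mul_star_mul_self _
  have h2 : x * (e * f) * x = x := star_mul_self_mul_star _
  have h2' (a : S) : x * (e * (f * (x * a))) = x * a := by
    simpa only [mul_assoc] using congrArg (· * a) h2
  have h3 : f * x * e = x := by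
    refine star_unique _ _ ?_ ?_
    · simp only [mul_assoc, he2, hf2] at h1 ⊢
      exact h1
    · simp only [mul_assoc, he2, hf2, h2']
  have h4 : IsIdem x := by
    rw [IsIdem]
    nth_rewrite 1 2 [← h3]
    simp only [mul_assoc, h2']
    rw [← mul_assoc, h3]
  have h5 : x = e * f := by rw [← star_star' (e * f), ← hx, star_eq_self h4]
  rwa [← h5]

theorem idem_comm {e f : S} (he : IsIdem e) (hf : IsIdem f) : e * f = f * e := by
  have hef : e * f * (e * f) = e * f := isIdem_mul he hf
  have hfe : f * e * (f * e) = f * e := isIdem_mul hf he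
  have he2 (a : S) : e * (e * a) = e * a := by rw [← mul_assoc, show e * e = e from he]
  have hf2 (a : S) : f * (f * a) = f * a := by rw [← mul_assoc, show f * f = f from hf]
  have h : f * e = star (e * f) := by
    refine star_unique _ _ ?_ ?_
    · simp only [mul_assoc, he2, hf2] at hef ⊢
      exact hef
    · simp only [mul_assoc, he2, hf2] at hfe ⊢
      exact hfe
  rw [h, star_eq_self (isIdem_mul he hf)]

theorem star_mul_rev (s t : S) : star (s * t) = star t * star s := by
  have h : star s * s * (t * star t) = t * star t * (star s * s) :=
    idem_comm (isIdem_star_mul_self s) (isIdem_mul_star_self t)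
  refine (star_unique _ _ ?_ ?_).symm
  · calc s * t * (star t * star s) * (s * t)
        = s * (t * star t * (star s * s)) * t := by simp only [mul_assoc]
      _ = s * star s * s * (t * star t * t) := by rw [← h]; simp only [mul_assoc]
      _ = s * t := by rw [mul_star_mul_self, mul_star_mul_self]
  · calc star t * star s * (s * t) * (star t * star s)
        = star t * (star s * s * (t * star t)) * star s := by simp only [mul_assoc]
      _ = star t * t * star t * (star s * s * star s) := by rw [h]; simp only [mul_assoc]
      _ = star t * star s := by rw [star_mul_self_mul_star, star_mul_self_mul_star]

theorem nLe_mul_star_iff {e s : S} (he : IsIdem e) : NLe (s * star s) e ↔ e * s = s := by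
  constructor
  · rintro ⟨f, -, hs⟩
    calc e * s = e * (s * star s * s) := by rw [mul_star_mul_self]
      _ = e * e * f * s := by rw [hs]; simp only [mul_assoc]
      _ = s := by rw [show e * e = e from he, ← hs, mul_star_mul_self]
  · intro h
    exact ⟨s * star s, isIdem_mul_star_self s, by rw [← mul_assoc, h]⟩

theorem eq_zero_of_star_mul_self_eq_zero [Zero S] (hz : ∀ s : S, 0 * s = 0 ∧ s * 0 = 0) {s : S}
    (h : star s * s = 0) : s = 0 := by
  rw [← mul_star_mul_self s, mul_assoc, h, (hz s).2]

end InverseSemigroup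

open CategoryTheory InverseSemigroup

/-- The idempotents of `S` satisfying `p`, as objects of a full subcategory of `L(S)`. -/
structure IdemObj {S : Type u} [InverseSemigroup S] (p : S → Prop) where
  val : S
  idem : IsIdem val
  prop : p val

/-- The morphisms of `L(S)`, with `s * star s ≤ e` written in the equivalent form `e * s = s`. -/
@[ext]
structure IdemObj.Hom {S : Type u} [InverseSemigroup S] {p : S → Prop} (e f : IdemObj p) where
  val : S
  mul_val : e.val * val = val
  star_mul_val : star val * val = f.val

namespace IdemObj

variable {S : Type u} [InverseSemigroup S] {p q : S → Prop}

instance : Category (IdemObj p) where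
  Hom := Hom
  id e := ⟨e.val, e.idem, by rw [star_eq_self e.idem]; exact e.idem⟩
  comp {e f g} s t :=
    { val := s.val * t.val
      mul_val := by rw [← mul_assoc, s.mul_val]
      star_mul_val := by
        rw [star_mul_rev, mul_assoc, ← mul_assoc (star s.val), s.star_mul_val, t.mul_val,
          t.star_mul_val] }
  id_comp s := Hom.ext s.mul_val
  comp_id {e f} s := Hom.ext (by
    change s.val * f.val = s.val
    rw [← s.star_mul_val, ← mul_assoc, mul_star_mul_self])
  assoc _ _ _ := Hom.ext (mul_assoc _ _ _)

@[ext]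
theorem hom_ext {e f : IdemObj p} {s t : e ⟶ f} (h : s.val = t.val) : s = t := Hom.ext h

/-- The isomorphism `x * star x ≅ star x * x` in `L(S)`. -/
def isoOfStar (e f : IdemObj p) (x : S) (he : x * star x = e.val) (hf : star x * x = f.val) :
    e ≅ f where
  hom := ⟨x, by rw [← he, mul_star_mul_self], hf⟩
  inv := ⟨star x, by rw [← hf, star_mul_self_mul_star], by rw [star_star', he]⟩
  hom_inv_id := hom_ext he
  inv_hom_id := hom_ext hf

/-- The inclusion between two full subcategories of `L(S)`. -/
def incl (h : ∀ e, p e → q e) : IdemObj p ⥤ IdemObj q where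
  obj e := ⟨e.val, e.idem, h _ e.prop⟩
  map s := ⟨s.val, s.mul_val, s.star_mul_val⟩

instance (h : ∀ e, p e → q e) : (incl h).Full where
  map_surjective s := ⟨⟨s.val, s.mul_val, s.star_mul_val⟩, rfl⟩

instance (h : ∀ e, p e → q e) : (incl h).Faithful where
  map_injective hst := hom_ext (congrArg Hom.val hst :)

end IdemObj

/-- `F0` and `F1` describe an equivalence between the full subcategories of `L(S)` and `L(T)` on
the idempotents satisfying `p` and `r`. -/
structure IsEquivOn {S : Type u} {T : Type v} [InverseSemigroup S] [InverseSemigroup T]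
    (p : S → Prop) (r : T → Prop) (F0 : S → T) (F1 : S → S → T) : Prop where
  idem : ∀ e, IsIdem e → p e → IsIdem (F0 e)
  prop : ∀ e, IsIdem e → p e → r (F0 e)
  mul_map : ∀ e s, IsIdem e → p e → p (star s * s) → e * s = s → F0 e * F1 e s = F1 e s
  star_mul_map : ∀ e s, IsIdem e → p e → p (star s * s) → e * s = s →
    star (F1 e s) * F1 e s = F0 (star s * s)
  map_id : ∀ e, IsIdem e → p e → F1 e e = F0 e
  map_comp : ∀ e s t, IsIdem e → p e → p (star s * s) → p (star t * t) → e * s = s →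
    star s * s * t = t → F1 e (s * t) = F1 e s * F1 (star s * s) t
  faithful : ∀ e s s', IsIdem e → p e → p (star s * s) → e * s = s → e * s' = s' →
    star s * s = star s' * s' → F1 e s = F1 e s' → s = s'
  full : ∀ e f u, IsIdem e → p e → IsIdem f → p f → F0 e * u = u → star u * u = F0 f →
    ∃ s, e * s = s ∧ star s * s = f ∧ F1 e s = u
  essSurj : ∀ g, IsIdem g → r g → ∃ e, IsIdem e ∧ p e ∧ ∃ x y, F0 e * x = x ∧ star x * x = g ∧
    g * y = y ∧ star y * y = F0 e ∧ x * y = F0 e ∧ y * x = g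

section

variable {S : Type u} {T : Type v} [InverseSemigroup S] [InverseSemigroup T]

theorem IsEquivOn.nonempty_equivalence {p : S → Prop} {r : T → Prop} {F0 : S → T} {F1 : S → S → T}
    (h : IsEquivOn p r F0 F1) : Nonempty (IdemObj p ≌ IdemObj r) := by
  have hp {e f : IdemObj p} (s : e ⟶ f) : p (star s.val * s.val) := by
    rw [s.star_mul_val]; exact f.prop
  let F : IdemObj p ⥤ IdemObj r :=
    { obj e := ⟨F0 e.val, h.idem _ e.idem e.prop, h.prop _ e.idem e.prop⟩
      map {e f} s := ⟨F1 e.val s.val, h.mul_map _ _ e.idem e.prop (hp s) s.mul_val, by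
        rw [h.star_mul_map _ _ e.idem e.prop (hp s) s.mul_val, s.star_mul_val]⟩
      map_id e := IdemObj.hom_ext (h.map_id _ e.idem e.prop)
      map_comp {e f g} s t := IdemObj.hom_ext (by
        have := h.map_comp _ _ _ e.idem e.prop (hp s) (hp t) s.mul_val
          (by rw [s.star_mul_val, t.mul_val])
        rw [s.star_mul_val] at this
        exact this) }
  have : F.Faithful := ⟨fun {e f s t} hst => IdemObj.hom_ext
    (h.faithful _ _ _ e.idem e.prop (hp s) s.mul_val t.mul_val
      (s.star_mul_val.trans t.star_mul_val.symm) (congrArg IdemObj.Hom.val hst))⟩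
  have : F.Full := ⟨fun {e f} u => by
    obtain ⟨s, h1, h2, h3⟩ := h.full _ _ u.val e.idem e.prop f.idem f.prop u.mul_val u.star_mul_val
    exact ⟨⟨s, h1, h2⟩, IdemObj.hom_ext h3⟩⟩
  have : F.EssSurj := ⟨fun g => by
    obtain ⟨e, he, hpe, x, y, hx, hx', hy, hy', hxy, hyx⟩ := h.essSurj _ g.idem g.prop
    exact ⟨⟨e, he, hpe⟩, ⟨⟨x, hx, hx'⟩, ⟨y, hy, hy'⟩, IdemObj.hom_ext hxy, IdemObj.hom_ext hyx⟩⟩⟩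
  have : F.IsEquivalence := {}
  exact ⟨F.asEquivalence⟩

open Classical in
theorem CategoryTheory.Equivalence.exists_isEquivOn [Zero T] {p : S → Prop} {r : T → Prop}
    (E : IdemObj p ≌ IdemObj r) : ∃ F0 F1, IsEquivOn p r F0 F1 := by
  let F := E.functor
  let F0 (e : S) : T := if h : IsIdem e ∧ p e then (F.obj ⟨e, h.1, h.2⟩).val else 0
  let F1 (e s : S) : T :=
    if h : (IsIdem e ∧ p e) ∧ p (star s * s) ∧ e * s = s then
      (F.map (X := ⟨e, h.1.1, h.1.2⟩) (Y := ⟨star s * s, isIdem_star_mul_self s, h.2.1⟩)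
        ⟨s, h.2.2, rfl⟩).val
    else 0
  have hF0 (e : IdemObj p) : F0 e.val = (F.obj e).val := dif_pos ⟨e.idem, e.prop⟩
  have hF1 {e f : IdemObj p} (s : e ⟶ f) : F1 e.val s.val = (F.map s).val := by
    obtain ⟨f, hf, hpf⟩ := f
    obtain ⟨s, hs, hs'⟩ := s
    dsimp only at hs'
    subst hs'
    exact dif_pos ⟨⟨e.idem, e.prop⟩, hpf, hs⟩
  let O (e : S) (he : IsIdem e) (hp : p e) : IdemObj p := ⟨e, he, hp⟩
  let M (e s : S) (he : IsIdem e) (hp : p e) (hs : p (star s * s)) (h : e * s = s) :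
    O e he hp ⟶ O _ (isIdem_star_mul_self s) hs := ⟨s, h, rfl⟩
  refine ⟨F0, F1, ?_, ?_, ?_, ?_, ?_, ?_, ?_, ?_, ?_⟩
  · intro e he hp
    rw [hF0 (O e he hp)]
    exact (F.obj _).idem
  · intro e he hp
    rw [hF0 (O e he hp)]
    exact (F.obj _).prop
  · intro e s he hp hps hs
    rw [hF0 (O e he hp), hF1 (M e s he hp hps hs)]
    exact (F.map _).mul_val
  · intro e s he hp hps hs
    rw [hF0 (O _ _ hps), hF1 (M e s he hp hps hs)]
    exact (F.map _).star_mul_val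
  · intro e he hp
    rw [hF0 (O e he hp)]
    exact (hF1 (𝟙 (O e he hp))).trans (by rw [F.map_id]; rfl)
  · intro e s t he hp hps hpt hs ht
    let t' : O _ (isIdem_star_mul_self s) hps ⟶ O _ (isIdem_star_mul_self t) hpt := ⟨t, ht, rfl⟩
    have h := hF1 (M e s he hp hps hs ≫ t')
    rw [F.map_comp] at h
    rw [hF1 (M e s he hp hps hs), hF1 t']
    exact h
  · intro e s s' he hp hps hs hs' hss h
    let s₂ : O e he hp ⟶ O _ (isIdem_star_mul_self s) hps := ⟨s', hs', hss.symm⟩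
    rw [hF1 (M e s he hp hps hs), hF1 s₂] at h
    exact congrArg IdemObj.Hom.val (F.map_injective (IdemObj.hom_ext h))
  · intro e f u he hpe hf hpf hu hu'
    rw [hF0 (O e he hpe)] at hu
    rw [hF0 (O f hf hpf)] at hu'
    obtain ⟨s, hs⟩ := F.map_surjective (X := O e he hpe) (Y := O f hf hpf) ⟨u, hu, hu'⟩
    exact ⟨s.val, s.mul_val, s.star_mul_val, (hF1 s).trans (congrArg IdemObj.Hom.val hs)⟩
  · intro g hg hrg
    let g' : IdemObj r := ⟨g, hg, hrg⟩
    let i := F.objObjPreimageIso g'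
    refine ⟨_, (F.objPreimage g').idem, (F.objPreimage g').prop, i.hom.val, i.inv.val, ?_⟩
    rw [hF0]
    exact ⟨i.hom.mul_val, i.hom.star_mul_val, i.inv.mul_val, i.inv.star_mul_val,
      congrArg IdemObj.Hom.val i.hom_inv_id, congrArg IdemObj.Hom.val i.inv_hom_id⟩

theorem exists_isEquivOn_iff [Zero T] {p : S → Prop} {r : T → Prop} :
    (∃ F0 F1, IsEquivOn p r F0 F1) ↔ Nonempty (IdemObj p ≌ IdemObj r) :=
  ⟨fun ⟨_, _, h⟩ => h.nonempty_equivalence, fun ⟨E⟩ => E.exists_isEquivOn⟩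

theorem isLEquiv_iff {F0 : S → T} {F1 : S → S → T} :
    IsLEquiv F0 F1 ↔ IsEquivOn (fun _ => True) (fun _ => True) F0 F1 := by
  constructor
  · rintro ⟨h0, h1, hid, hcomp, hf, hfull, hs⟩
    refine ⟨fun e he _ => h0 e he, fun _ _ _ => trivial, ?_, ?_, fun e he _ => hid e he,
      ?_, ?_, ?_, ?_⟩
    · intro e s he _ _ hs
      exact (nLe_mul_star_iff (h0 e he)).1 (h1 e s he ((nLe_mul_star_iff he).2 hs)).1
    · intro e s he _ _ hs
      exact (h1 e s he ((nLe_mul_star_iff he).2 hs)).2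
    · intro e s t he _ _ _ hs ht
      exact hcomp e s t he ((nLe_mul_star_iff he).2 hs)
        ((nLe_mul_star_iff (isIdem_star_mul_self s)).2 ht)
    · intro e s s' he _ _ hs hs'
      exact hf e s s' he ((nLe_mul_star_iff he).2 hs) ((nLe_mul_star_iff he).2 hs')
    · intro e f u he _ hfi _ hu hu'
      obtain ⟨s, hs, h⟩ := hfull e f u he hfi ((nLe_mul_star_iff (h0 e he)).2 hu) hu'
      exact ⟨s, (nLe_mul_star_iff he).1 hs, h⟩
    · intro g hg _
      obtain ⟨e, he, x, y, hx, hx', hy, h⟩ := hs g hg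
      exact ⟨e, he, trivial, x, y, (nLe_mul_star_iff (h0 e he)).1 hx, hx',
        (nLe_mul_star_iff hg).1 hy, h⟩
  · intro h
    have h0 (e : S) (he : IsIdem e) : IsIdem (F0 e) := h.idem e he trivial
    refine ⟨h0, ?_, fun e he => h.map_id e he trivial, ?_, ?_, ?_, ?_⟩
    · intro e s he hs
      rw [nLe_mul_star_iff he] at hs
      exact ⟨(nLe_mul_star_iff (h0 e he)).2 (h.mul_map e s he trivial trivial hs),
        h.star_mul_map e s he trivial trivial hs⟩
    · intro e s t he hs ht
      exact h.map_comp e s t he trivial trivial trivial ((nLe_mul_star_iff he).1 hs)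
        ((nLe_mul_star_iff (isIdem_star_mul_self s)).1 ht)
    · intro e s s' he hs hs'
      exact h.faithful e s s' he trivial trivial ((nLe_mul_star_iff he).1 hs)
        ((nLe_mul_star_iff he).1 hs')
    · intro e f u he hf hu hu'
      obtain ⟨s, hs, h'⟩ := h.full e f u he trivial hf trivial
        ((nLe_mul_star_iff (h0 e he)).1 hu) hu'
      exact ⟨s, (nLe_mul_star_iff he).2 hs, h'⟩
    · intro g hg
      obtain ⟨e, he, _, x, y, hx, hx', hy, h'⟩ := h.essSurj g hg trivial
      exact ⟨e, he, x, y, (nLe_mul_star_iff (h0 e he)).2 hx, hx', (nLe_mul_star_iff hg).2 hy, h'⟩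

theorem pMor_iff [Zero S] (hz : ∀ s : S, 0 * s = 0 ∧ s * 0 = 0) {e s : S} :
    PMor 0 e s ↔ IsMaxIdem 0 e ∧ IsMaxIdem 0 (star s * s) ∧ e * s = s := by
  constructor
  · rintro ⟨he, hs, -, h⟩
    exact ⟨he, hs, (nLe_mul_star_iff he.1).1 h⟩
  · rintro ⟨he, hs, h⟩
    refine ⟨he, hs, fun h0 => hs.2.1 ?_, (nLe_mul_star_iff he.1).2 h⟩
    rw [← mul_star_mul_self s, h0, (hz s).1, (hz _).2]

theorem isPEquiv_iff [Zero S] [Zero T] (hzS : ∀ s : S, 0 * s = 0 ∧ s * 0 = 0)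
    (hzT : ∀ t : T, 0 * t = 0 ∧ t * 0 = 0) {F0 : S → T} {F1 : S → S → T} :
    IsPEquiv 0 0 F0 F1 ↔ IsEquivOn (IsMaxIdem 0) (IsMaxIdem 0) F0 F1 := by
  simp only [IsPEquiv, pMor_iff hzS, pMor_iff hzT]
  constructor
  · rintro ⟨h0, h1, hid, hcomp, hf, hfull, hs⟩
    refine ⟨fun e _ he => (h0 e he).1, fun e _ he => h0 e he, ?_, ?_, fun e _ he => hid e he,
      ?_, ?_, ?_, ?_⟩
    · intro e s _ he hps hs
      exact (h1 e s ⟨he, hps, hs⟩).1.2.2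
    · intro e s _ he hps hs
      exact (h1 e s ⟨he, hps, hs⟩).2
    · intro e s t _ he hps hpt hs ht
      exact hcomp e s t ⟨he, hps, hs⟩ ⟨hps, hpt, ht⟩
    · intro e s s' _ he hps hs hs' hss
      exact hf e s s' ⟨he, hps, hs⟩ ⟨he, hss ▸ hps, hs'⟩ hss
    · intro e f u _ he _ hfi hu hu'
      obtain ⟨s, hs, h⟩ := hfull e f u he hfi ⟨h0 e he, hu' ▸ h0 f hfi, hu⟩ hu'
      exact ⟨s, hs.2.2, h⟩
    · intro g _ hg
      obtain ⟨e, he, x, y, hx, hx', hy, h⟩ := hs g hg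
      exact ⟨e, he.1, he, x, y, hx.2.2, hx', hy.2.2, h⟩
  · intro h
    have h0 (e : S) (he : IsMaxIdem 0 e) : IsMaxIdem 0 (F0 e) := h.prop e he.1 he
    refine ⟨h0, ?_, fun e he => h.map_id e he.1 he, ?_, ?_, ?_, ?_⟩
    · rintro e s ⟨he, hps, hs⟩
      have h' := h.star_mul_map e s he.1 he hps hs
      exact ⟨⟨h0 e he, h' ▸ h0 _ hps, h.mul_map e s he.1 he hps hs⟩, h'⟩
    · rintro e s t ⟨he, hps, hs⟩ ⟨-, hpt, ht⟩
      exact h.map_comp e s t he.1 he hps hpt hs ht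
    · rintro e s s' ⟨he, hps, hs⟩ ⟨-, -, hs'⟩
      exact h.faithful e s s' he.1 he hps hs hs'
    · rintro e f u he hf ⟨-, -, hu⟩ hu'
      obtain ⟨s, hs, hs', h'⟩ := h.full e f u he.1 he hf.1 hf hu hu'
      exact ⟨s, ⟨he, hs' ▸ hf, hs⟩, hs', h'⟩
    · intro g hg
      obtain ⟨e, -, he, x, y, hx, hx', hy, hy', h'⟩ := h.essSurj g hg.1 hg
      exact ⟨e, he, x, y, ⟨h0 e he, hx' ▸ hg, hx⟩, hx', ⟨hg, hy' ▸ h0 e he, hy⟩, hy', h'⟩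

end

section

variable {S : Type u} [InverseSemigroup S] [Zero S] (hz : ∀ s : S, 0 * s = 0 ∧ s * 0 = 0)
  {T : Type v} [InverseSemigroup T] [Zero T] (hzT : ∀ t : T, 0 * t = 0 ∧ t * 0 = 0)

namespace IdemObj

/-- The zero of `S`, as an object of `L(S)`. -/
def zero : IdemObj (fun _ : S => True) := ⟨0, (hz 0).1, trivial⟩

/-- The zero of `S` is a terminal object of `L(S)`. -/
def zeroTerminal : Limits.IsTerminal (zero hz) :=
  letI (e : IdemObj (fun _ : S => True)) : Unique (e ⟶ zero hz) :=
    { default := ⟨0, (hz _).2, (hz _).2⟩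
      uniq s := hom_ext (eq_zero_of_star_mul_self_eq_zero hz s.star_mul_val) }
  Limits.IsTerminal.ofUnique _

include hz in
theorem eq_zero_iff_forall_nonempty_hom (e : IdemObj (fun _ : S => True)) :
    e.val = 0 ↔ ∀ f, Nonempty (f ⟶ e) := by
  constructor
  · intro he f
    exact ⟨⟨0, (hz _).2, by rw [he, (hz _).2]⟩⟩
  · intro h
    obtain ⟨s⟩ := h (zero hz)
    have hs : s.val = 0 := by rw [← s.mul_val]; exact (hz _).1
    rw [← s.star_mul_val, hs, (hz _).2]

/-- `L(S)` is obtained from its full subcategory on the nonzero idempotents by adjoining a terminal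
object. -/
noncomputable def withTerminalEquivalence :
    WithTerminal (IdemObj (fun e : S => e ≠ 0)) ≌ IdemObj (fun _ : S => True) :=
  let F := WithTerminal.liftToTerminal (incl (q := fun _ : S => True) (p := fun e : S => e ≠ 0)
    fun _ _ => trivial) (zeroTerminal hz)
  have : F.Faithful := ⟨by
    rintro (X | _) (Y | _) f g h
    · exact (incl fun _ _ => trivial).map_injective h
    · exact Subsingleton.elim _ _
    · exact (WithTerminal.false_of_from_star f).elim
    · exact Subsingleton.elim _ _⟩
  have : F.Full := ⟨by
    rintro (X | _) (Y | _) f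
    · exact (incl (q := fun _ : S => True) (p := fun e : S => e ≠ 0)
        fun _ _ => trivial).map_surjective f
    · exact ⟨WithTerminal.starTerminal.from _, (zeroTerminal hz).hom_ext _ _⟩
    · refine (Y.prop ?_).elim
      refine (eq_zero_iff_forall_nonempty_hom hz (F.obj (.of Y))).2 fun e => ?_
      exact ⟨(zeroTerminal hz).from e ≫ f⟩
    · exact ⟨𝟙 _, (zeroTerminal hz).hom_ext _ _⟩⟩
  have : F.EssSurj := ⟨fun e => by
    by_cases h : e.val = 0
    · exact ⟨.star, ⟨eqToIso (by cases e; cases h; rfl)⟩⟩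
    · exact ⟨.of ⟨e.val, e.idem, h⟩, ⟨Iso.refl _⟩⟩⟩
  have : F.IsEquivalence := {}
  F.asEquivalence

theorem nonempty_equivalence_nonzero (hP4 : ∀ e : S, IsIdem e → e ≠ 0 →
      ∃ m x : S, IsMaxIdem (0 : S) m ∧ star x * x = e ∧ x * star x = m) :
    Nonempty (IdemObj (IsMaxIdem (0 : S)) ≌ IdemObj (fun e : S => e ≠ 0)) := by
  let F := incl (p := IsMaxIdem (0 : S)) (q := fun e : S => e ≠ 0) fun _ h => h.2.1
  have : F.EssSurj := ⟨fun e => by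
    obtain ⟨m, x, hm, hx, hx'⟩ := hP4 e.val e.idem e.prop
    exact ⟨⟨m, hm.1, hm⟩, ⟨isoOfStar _ _ x hx' hx⟩⟩⟩
  have : F.IsEquivalence := {}
  exact ⟨F.asEquivalence⟩

include hz hzT in
theorem map_eq_zero_iff (E : IdemObj (fun _ : S => True) ≌ IdemObj (fun _ : T => True))
    (e : IdemObj (fun _ : S => True)) : (E.functor.obj e).val = 0 ↔ e.val = 0 := by
  rw [eq_zero_iff_forall_nonempty_hom hz, eq_zero_iff_forall_nonempty_hom hzT]
  constructor
  · intro h f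
    exact (h (E.functor.obj f)).map E.functor.preimage
  · intro h f
    exact (h (E.inverse.obj f)).map fun s => E.counitInv.app f ≫ E.functor.map s

include hz hzT in
theorem nonempty_equivalence_restrict
    (E : IdemObj (fun _ : S => True) ≌ IdemObj (fun _ : T => True)) :
    Nonempty (IdemObj (fun e : S => e ≠ 0) ≌ IdemObj (fun e : T => e ≠ 0)) := by
  let I := incl (p := fun e : S => e ≠ 0) (q := fun _ => True) fun _ _ => trivial
  let J := incl (p := fun e : T => e ≠ 0) (q := fun _ => True) fun _ _ => trivial
  let G := I ⋙ E.functor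
  let F : IdemObj (fun e : S => e ≠ 0) ⥤ IdemObj (fun e : T => e ≠ 0) :=
    { obj e := ⟨(G.obj e).val, (G.obj e).idem,
        fun h => e.prop ((map_eq_zero_iff hz hzT E (I.obj e)).1 h)⟩
      map s := ⟨(G.map s).val, (G.map s).mul_val, (G.map s).star_mul_val⟩
      map_id e := hom_ext (congrArg Hom.val (G.map_id e) :)
      map_comp s t := hom_ext (congrArg Hom.val (G.map_comp s t) :) }
  have : F.Faithful := ⟨fun h => G.map_injective (hom_ext (congrArg Hom.val h :))⟩
  have : F.Full := ⟨fun {e f} u => by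
    obtain ⟨s, hs⟩ := G.map_surjective (X := e) (Y := f) ⟨u.val, u.mul_val, u.star_mul_val⟩
    exact ⟨s, hom_ext (congrArg Hom.val hs :)⟩⟩
  have : F.EssSurj := ⟨fun g => by
    let e := E.functor.objPreimage (J.obj g)
    let i : E.functor.obj e ≅ J.obj g := E.functor.objObjPreimageIso (J.obj g)
    have he : e.val ≠ 0 := by
      rw [Ne, ← map_eq_zero_iff hz hzT E, eq_zero_iff_forall_nonempty_hom hzT]
      intro h
      exact g.prop ((eq_zero_iff_forall_nonempty_hom hzT (J.obj g)).2
        fun f => (h f).map (· ≫ i.hom))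
    exact ⟨⟨e.val, e.idem, he⟩, ⟨J.preimageIso i⟩⟩⟩
  have : F.IsEquivalence := {}
  exact ⟨F.asEquivalence⟩

end IdemObj

end

theorem CategoryTheory.WithTerminal.isEquivalence_map {C D : Type*} [Category* C] [Category* D]
    (F : C ⥤ D) [F.IsEquivalence] : (map F).IsEquivalence where
  faithful := ⟨by
    rintro (X | _) (Y | _) f g h
    · exact F.map_injective h
    · exact Subsingleton.elim _ _
    · exact (false_of_from_star f).elim
    · exact Subsingleton.elim _ _⟩
  full := ⟨by
    rintro (X | _) (Y | _) f
    · exact F.map_surjective (X := X) (Y := Y) f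
    · exact ⟨starTerminal.from _, rfl⟩
    · exact (false_of_from_star f).elim
    · exact ⟨𝟙 _, rfl⟩⟩
  essSurj := ⟨by
    rintro (X | _)
    · exact ⟨of (F.objPreimage X), ⟨incl.mapIso (F.objObjPreimageIso X)⟩⟩
    · exact ⟨star, ⟨Iso.refl _⟩⟩⟩

/-- STATEMENT 9: if `S` and `T` are inverse semigroups with zero satisfying (P3)
and (P4), then `S` is Morita equivalent to `T` (i.e. `L(S)` and `L(T)` are
equivalent) if and only if the path categories `P(S)` and `P(T)` are
equivalent. -/
theorem stmt9 {S : Type u} {T : Type v} [InverseSemigroup S] [InverseSemigroup T]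
    [Zero S] [Zero T]
    (hzS : ∀ s : S, 0 * s = 0 ∧ s * 0 = 0)
    (hzT : ∀ t : T, 0 * t = 0 ∧ t * 0 = 0)
    (hP3S : ∀ e : S, IsIdem e → e ≠ 0 → ∃! m : S, IsMaxIdem (0 : S) m ∧ NLe e m)
    (hP4S : ∀ e : S, IsIdem e → e ≠ 0 →
      ∃ m x : S, IsMaxIdem (0 : S) m ∧ star x * x = e ∧ x * star x = m)
    (hP3T : ∀ e : T, IsIdem e → e ≠ 0 → ∃! m : T, IsMaxIdem (0 : T) m ∧ NLe e m)
    (hP4T : ∀ e : T, IsIdem e → e ≠ 0 →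
      ∃ m x : T, IsMaxIdem (0 : T) m ∧ star x * x = e ∧ x * star x = m) :
    MoritaEquiv S T ↔
      ∃ (F0 : S → T) (F1 : S → S → T), IsPEquiv (0 : S) (0 : T) F0 F1 := by
  simp only [MoritaEquiv, isLEquiv_iff, isPEquiv_iff hzS hzT, exists_isEquivOn_iff]
  obtain ⟨ES⟩ := IdemObj.nonempty_equivalence_nonzero hP4S
  obtain ⟨ET⟩ := IdemObj.nonempty_equivalence_nonzero hP4T
  constructor
  · rintro ⟨E⟩
    obtain ⟨E'⟩ := IdemObj.nonempty_equivalence_restrict hzS hzT E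
    exact ⟨(ES.trans E').trans ET.symm⟩
  · rintro ⟨E⟩
    let F := ((ES.symm.trans E).trans ET).functor
    have := WithTerminal.isEquivalence_map F
    exact ⟨(IdemObj.withTerminalEquivalence hzS).symm.trans
      ((WithTerminal.map F).asEquivalence.trans (IdemObj.withTerminalEquivalence hzT))⟩
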